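/- Let g be a smooth metric on ℝ^n whose matrix g(x) is invertible at every point, with pointwise inverse g^{··}, let Γ0_{kij} = ½(∂_i g_{jk} + ∂_j g_{ik} − ∂_k g_{ij}), Γ0^m_{ij} = Σ_l g^{ml} Γ0_{lij}, and let N_{ijk} : ℝ^n → ℝ be a smooth (0,3)-tensor field that is symmetric in its first two indices, N_{ijk} = N_{jik}. Define Γ^m_{ij} = Γ0^m_{ij} + Σ_l g^{ml} N_{lij} and Γ⋆^m_{ij} = Γ0^m_{ij} − Σ_l g^{ml} N_{lij}. Then for all i,j,k,l at every point: Σ_m g_{im} R(Γ)^m_{jkl} = −Σ_m g_{jm} R(Γ⋆)^m_{ikl}. Consequently, R(Γ) vanishes identically if and only if R(Γ⋆) vanishes identically. -/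

import Mathlib

noncomputable section
open scoped BigOperators

/-- The `i`-th partial derivative of `f : ℝⁿ → ℝ` at `x`. -/
def pd {n : ℕ} (i : Fin n) (f : EuclideanSpace ℝ (Fin n) → ℝ)
    (x : EuclideanSpace ℝ (Fin n)) : ℝ :=
  fderiv ℝ f x (EuclideanSpace.single i 1)

/-- Lowered Levi-Civita (Koszul) coefficients Γ0_{kij}. -/
def LC {n : ℕ} (g : EuclideanSpace ℝ (Fin n) → Fin n → Fin n → ℝ)
    (k i j : Fin n) (x : EuclideanSpace ℝ (Fin n)) : ℝ :=
  (pd i (fun y => g y j k) x + pd j (fun y => g y i k) x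
    - pd k (fun y => g y i j) x) / 2

/-- Riemann curvature tensor R(Γ)^m_{ijk} of a connection given by
coefficients `Γ m i j = Γ^m_{ij}`. -/
def Riem {n : ℕ} (Γ : Fin n → Fin n → Fin n → EuclideanSpace ℝ (Fin n) → ℝ)
    (m i j k : Fin n) (x : EuclideanSpace ℝ (Fin n)) : ℝ :=
  pd j (Γ m i k) x - pd k (Γ m i j) x
    + ∑ l, (Γ m l j x * Γ l i k x - Γ m l k x * Γ l i j x)

theorem pd_comm {n : ℕ} {f : EuclideanSpace ℝ (Fin n) → ℝ} (hf : ContDiff ℝ (⊤ : ℕ∞) f)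
    (i j : Fin n) (x : EuclideanSpace ℝ (Fin n)) : pd i (pd j f) x = pd j (pd i f) x := by
  have hd : DifferentiableAt ℝ (fderiv ℝ f) x :=
    (hf.fderiv_right (m := 1) (by norm_cast)).differentiable (by simp) x
  have key (a b : Fin n) : pd a (pd b f) x =
      fderiv ℝ (fderiv ℝ f) x (EuclideanSpace.single a 1) (EuclideanSpace.single b 1) := by
    have h := hd.hasFDerivAt.clm_apply
      (hasFDerivAt_const (EuclideanSpace.single b (1 : ℝ)) x)
    change fderiv ℝ (fun y => fderiv ℝ f y (EuclideanSpace.single b 1)) x _ = _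
    rw [h.fderiv]
    simp
  rw [key, key]
  have hs : IsSymmSndFDerivAt ℝ f x :=
    hf.contDiffAt.isSymmSndFDerivAt (by simp; norm_cast)
  exact hs.eq _ _

theorem differentiable_pd {n : ℕ} {f : EuclideanSpace ℝ (Fin n) → ℝ}
    (hf : ContDiff ℝ (⊤ : ℕ∞) f) (i : Fin n) : Differentiable ℝ (pd i f) := by
  have hd : Differentiable ℝ (fderiv ℝ f) :=
    (hf.fderiv_right (m := 1) (by norm_cast)).differentiable (by simp)
  exact hd.clm_apply (differentiable_const _)

theorem pd_add {n : ℕ} {f h : EuclideanSpace ℝ (Fin n) → ℝ} {x : EuclideanSpace ℝ (Fin n)}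
    (hf : DifferentiableAt ℝ f x) (hh : DifferentiableAt ℝ h x) (i : Fin n) :
    pd i (fun y => f y + h y) x = pd i f x + pd i h x := by
  simp [pd, fderiv_fun_add hf hh]

theorem pd_sum_mul {n : ℕ} {ι : Type*} [Fintype ι] {f h : ι → EuclideanSpace ℝ (Fin n) → ℝ}
    {x : EuclideanSpace ℝ (Fin n)} (hf : ∀ m, DifferentiableAt ℝ (f m) x)
    (hh : ∀ m, DifferentiableAt ℝ (h m) x) (i : Fin n) :
    pd i (fun y => ∑ m, f m y * h m y) x = ∑ m, (f m x * pd i (h m) x + pd i (f m) x * h m x) := by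
  unfold pd
  rw [fderiv_fun_sum fun m _ => (hf m).fun_mul (hh m), sum_apply]
  refine Finset.sum_congr rfl fun m _ => ?_
  rw [fderiv_fun_mul (hf m) (hh m)]
  simp [mul_comm]

theorem differentiable_det {E ι : Type*} [NormedAddCommGroup E] [NormedSpace ℝ E] [Fintype ι]
    [DecidableEq ι] {A : E → Matrix ι ι ℝ} (hA : ∀ i j, Differentiable ℝ fun x => A x i j) :
    Differentiable ℝ fun x => (A x).det := by
  simp only [Matrix.det_apply']
  fun_prop

theorem differentiable_inv_apply {E ι : Type*} [NormedAddCommGroup E] [NormedSpace ℝ E] [Fintype ι]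
    [DecidableEq ι] {A : E → Matrix ι ι ℝ} (hA : ∀ i j, Differentiable ℝ fun x => A x i j)
    (hdet : ∀ x, IsUnit (A x).det) (i j : ι) : Differentiable ℝ fun x => (A x)⁻¹ i j := by
  have hadj : Differentiable ℝ fun x => (A x).adjugate i j := by
    simp only [Matrix.adjugate_apply]
    refine differentiable_det fun a b => ?_
    by_cases h : a = j
    · subst h
      simp
    · simpa [Matrix.updateRow_ne h] using hA a b
  simp only [Matrix.inv_def, Ring.inverse_eq_inv', Matrix.smul_apply, smul_eq_mul]
  exact ((differentiable_det hA).inv fun x => (hdet x).ne_zero).mul hadj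

/-- Lowering the upper index of the curvature of `Γ`, when `γ` is the lowered connection and `δ` is
the lowered dual connection, i.e. `∂_k g_{im} = γ_{imk} + δ_{mik}`. -/
theorem sum_mul_Riem {n : ℕ} {g : EuclideanSpace ℝ (Fin n) → Fin n → Fin n → ℝ}
    {Γ γ δ : Fin n → Fin n → Fin n → EuclideanSpace ℝ (Fin n) → ℝ}
    (hg : ∀ i j, Differentiable ℝ fun x => g x i j) (hΓ : ∀ m i j, Differentiable ℝ (Γ m i j))
    (hγ : ∀ i j k x, γ i j k x = ∑ m, g x i m * Γ m j k x)
    (hdual : ∀ i m k x, pd k (fun y => g y i m) x = γ i m k x + δ m i k x)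
    (i j k l : Fin n) (x : EuclideanSpace ℝ (Fin n)) :
    ∑ m, g x i m * Riem Γ m j k l x = pd k (γ i j l) x - pd l (γ i j k) x
      - ∑ m, (δ m i k x * Γ m j l x - δ m i l x * Γ m j k x) := by
  have hpd (k l : Fin n) : pd k (γ i j l) x = ∑ m, g x i m * pd k (Γ m j l) x
      + ∑ m, (γ i m k x + δ m i k x) * Γ m j l x := by
    rw [show γ i j l = fun y => ∑ m, g y i m * Γ m j l y from funext (hγ i j l),
      pd_sum_mul (fun m => hg i m x) (fun m => hΓ m j l x), Finset.sum_add_distrib]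
    simp only [hdual]
  have hquad (k l : Fin n) : ∑ m, g x i m * ∑ p, Γ m p k x * Γ p j l x
      = ∑ p, γ i p k x * Γ p j l x := by
    simp only [hγ, Finset.mul_sum, Finset.sum_mul]
    rw [Finset.sum_comm]
    simp only [mul_assoc]
  have hL : ∑ m, g x i m * Riem Γ m j k l x =
      ∑ m, g x i m * pd k (Γ m j l) x - ∑ m, g x i m * pd l (Γ m j k) x
      + (∑ p, γ i p k x * Γ p j l x - ∑ p, γ i p l x * Γ p j k x) := by
    rw [← hquad, ← hquad]
    simp only [Riem, mul_add, mul_sub, Finset.sum_add_distrib, Finset.sum_sub_distrib]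
  rw [hL, hpd, hpd]
  simp only [add_mul, Finset.sum_add_distrib, Finset.sum_sub_distrib]
  ring

/-- Curvatures of two connections that are dual with respect to `g`. -/
theorem sum_mul_Riem_eq_neg_of_dual {n : ℕ} {g : EuclideanSpace ℝ (Fin n) → Fin n → Fin n → ℝ}
    {Γ Γs γ γs : Fin n → Fin n → Fin n → EuclideanSpace ℝ (Fin n) → ℝ}
    (hg : ∀ i j, ContDiff ℝ (⊤ : ℕ∞) fun x => g x i j) (hsymm : ∀ x i j, g x i j = g x j i)
    (hΓ : ∀ m i j, Differentiable ℝ (Γ m i j)) (hΓs : ∀ m i j, Differentiable ℝ (Γs m i j))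
    (hγ : ∀ i j k x, γ i j k x = ∑ m, g x i m * Γ m j k x)
    (hγs : ∀ i j k x, γs i j k x = ∑ m, g x i m * Γs m j k x)
    (hdual : ∀ i m k x, pd k (fun y => g y i m) x = γ i m k x + γs m i k x)
    (i j k l : Fin n) (x : EuclideanSpace ℝ (Fin n)) :
    ∑ m, g x i m * Riem Γ m j k l x = - ∑ m, g x j m * Riem Γs m i k l x := by
  have hgd (i j : Fin n) : Differentiable ℝ fun x => g x i j := (hg i j).differentiable (by simp)
  have hdual' (i m k : Fin n) (x) : pd k (fun y => g y i m) x = γs i m k x + γ m i k x := by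
    simp only [hsymm _ i m, hdual, add_comm]
  have hγd (i j k : Fin n) : Differentiable ℝ (γ i j k) := by
    rw [show γ i j k = fun y => ∑ m, g y i m * Γ m j k y from funext (hγ i j k)]
    fun_prop
  have hγsd (i j k : Fin n) : Differentiable ℝ (γs i j k) := by
    rw [show γs i j k = fun y => ∑ m, g y i m * Γs m j k y from funext (hγs i j k)]
    fun_prop
  have hmixed (k l : Fin n) : pd k (pd l fun y => g y i j) x
      = pd k (γ i j l) x + pd k (γs j i l) x := by
    rw [← pd_add (hγd i j l x) (hγsd j i l x)]
    exact congrArg (fun f => pd k f x) (funext (hdual i j l))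
  have hquad (k l : Fin n) : ∑ m, γs m i k x * Γ m j l x = ∑ m, γ m j l x * Γs m i k x := by
    simp only [hγ, hγs, Finset.sum_mul]
    rw [Finset.sum_comm]
    refine Finset.sum_congr rfl fun p _ => Finset.sum_congr rfl fun m _ => ?_
    rw [hsymm x m p]
    ring
  rw [sum_mul_Riem hgd hΓ hγ hdual, sum_mul_Riem hgd hΓs hγs hdual']
  have hcomm := pd_comm (hg i j) k l x
  rw [hmixed, hmixed] at hcomm
  simp only [Finset.sum_sub_distrib, hquad]
  linarith

theorem sum_mul_sum_of_inverse {ι : Type*} [Fintype ι] [DecidableEq ι] {A B : ι → ι → ℝ}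
    (h : ∀ i j, ∑ k, A i k * B k j = if i = j then (1 : ℝ) else 0) (v : ι → ℝ) (i : ι) :
    ∑ m, A i m * ∑ l, B m l * v l = v i := by
  simp only [Finset.mul_sum, ← mul_assoc]
  rw [Finset.sum_comm]
  simp [← Finset.sum_mul, h]

theorem eq_zero_of_sum_mul_eq_zero {ι : Type*} [Fintype ι] [DecidableEq ι] {A B : ι → ι → ℝ}
    (h : ∀ i j, ∑ k, B i k * A k j = if i = j then (1 : ℝ) else 0) {v : ι → ℝ}
    (hv : ∀ i, ∑ m, A i m * v m = 0) (i : ι) : v i = 0 := by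
  rw [← sum_mul_sum_of_inverse h v i]
  simp [hv]

theorem LC_add_LC_swap {n : ℕ} {g : EuclideanSpace ℝ (Fin n) → Fin n → Fin n → ℝ}
    (hsymm : ∀ x i j, g x i j = g x j i) (i m k : Fin n) (x : EuclideanSpace ℝ (Fin n)) :
    LC g i m k x + LC g m i k x = pd k (fun y => g y i m) x := by
  simp only [LC, hsymm _ k i, hsymm _ k m, hsymm _ m i]
  ring

theorem statement8 {n : ℕ}
    (g ginv : EuclideanSpace ℝ (Fin n) → Fin n → Fin n → ℝ)
    (hg_smooth : ∀ j k, ContDiff ℝ (⊤ : ℕ∞) (fun x => g x j k))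
    (hg_symm : ∀ x j k, g x j k = g x k j)
    -- g(x) is invertible at every point with pointwise inverse ginv
    (hinv : ∀ x i j, ∑ k, g x i k * ginv x k j = if i = j then (1:ℝ) else 0)
    (hinv' : ∀ x i j, ∑ k, ginv x i k * g x k j = if i = j then (1:ℝ) else 0)
    -- smooth (0,3)-tensor field N, symmetric in its first two indices
    (N : Fin n → Fin n → Fin n → EuclideanSpace ℝ (Fin n) → ℝ)
    (hN_smooth : ∀ i j k, ContDiff ℝ (⊤ : ℕ∞) (fun x => N i j k x))
    (hNsym : ∀ i j k x, N i j k x = N j i k x)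
    -- the two connections Γ = Γ0 + g⁻¹N and Γ⋆ = Γ0 - g⁻¹N
    (Γ0u Γ Γs : Fin n → Fin n → Fin n → EuclideanSpace ℝ (Fin n) → ℝ)
    (hΓ0u : ∀ m i j x, Γ0u m i j x = ∑ l, ginv x m l * LC g l i j x)
    (hΓ : ∀ m i j x, Γ m i j x = Γ0u m i j x + ∑ l, ginv x m l * N l i j x)
    (hΓs : ∀ m i j x, Γs m i j x = Γ0u m i j x - ∑ l, ginv x m l * N l i j x) :
    (∀ i j k l x, (∑ m, g x i m * Riem Γ m j k l x)
        = - ∑ m, g x j m * Riem Γs m i k l x) ∧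
    ((∀ m j k l x, Riem Γ m j k l x = 0) ↔ (∀ m j k l x, Riem Γs m j k l x = 0)) := by
  have hgd (i j : Fin n) : Differentiable ℝ fun x => g x i j :=
    (hg_smooth i j).differentiable (by simp)
  have hNd (i j k : Fin n) : Differentiable ℝ (N i j k) :=
    (hN_smooth i j k).differentiable (by simp)
  have hginvd (i j : Fin n) : Differentiable ℝ fun x => ginv x i j := by
    have hmul (x) : Matrix.of (g x) * Matrix.of (ginv x) = 1 := by
      ext i j
      simp [Matrix.mul_apply, hinv, Matrix.one_apply]
    have h := differentiable_inv_apply (A := fun x => Matrix.of (g x)) hgd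
      (fun x => Matrix.isUnit_det_of_right_inverse (hmul x)) i j
    simpa only [Matrix.inv_eq_right_inv (hmul _), Matrix.of_apply] using h
  have hLCd (l i j : Fin n) : Differentiable ℝ (LC g l i j) := by
    have h (a b c : Fin n) := differentiable_pd (hg_smooth b c) a
    change Differentiable ℝ fun x => LC g l i j x
    simp only [LC, div_eq_mul_inv]
    exact (((h i j l).add (h j i l)).sub (h l i j)).mul_const (2⁻¹ : ℝ)
  have hΓd (m i j : Fin n) : Differentiable ℝ (Γ m i j) := by
    rw [funext (hΓ m i j)]
    simp only [hΓ0u]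
    fun_prop
  have hΓsd (m i j : Fin n) : Differentiable ℝ (Γs m i j) := by
    rw [funext (hΓs m i j)]
    simp only [hΓ0u]
    fun_prop
  have hγ (i j k : Fin n) (x) : LC g i j k x + N i j k x = ∑ m, g x i m * Γ m j k x := by
    simp only [hΓ, hΓ0u, mul_add, Finset.sum_add_distrib]
    rw [sum_mul_sum_of_inverse (hinv x) (fun l => LC g l j k x),
      sum_mul_sum_of_inverse (hinv x) (fun l => N l j k x)]
  have hγs (i j k : Fin n) (x) : LC g i j k x - N i j k x = ∑ m, g x i m * Γs m j k x := by
    simp only [hΓs, hΓ0u, mul_sub, Finset.sum_sub_distrib]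
    rw [sum_mul_sum_of_inverse (hinv x) (fun l => LC g l j k x),
      sum_mul_sum_of_inverse (hinv x) (fun l => N l j k x)]
  have hdual (i m k : Fin n) (x) : pd k (fun y => g y i m) x
      = (LC g i m k x + N i m k x) + (LC g m i k x - N m i k x) := by
    rw [← LC_add_LC_swap hg_symm, hNsym i m k x]
    ring
  have key := sum_mul_Riem_eq_neg_of_dual (γ := fun i j k x => LC g i j k x + N i j k x)
    (γs := fun i j k x => LC g i j k x - N i j k x) hg_smooth hg_symm hΓd hΓsd hγ hγs hdual
  refine ⟨key, fun h m j k l x => ?_, fun h m j k l x => ?_⟩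
  · refine eq_zero_of_sum_mul_eq_zero (hinv' x) (v := fun m => Riem Γs m j k l x) (fun i => ?_) m
    simpa [h] using key j i k l x
  · refine eq_zero_of_sum_mul_eq_zero (hinv' x) (v := fun m => Riem Γ m j k l x) (fun i => ?_) m
    simpa [h] using key i j k l x
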